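/- The zero eigenvalue of the Kirchhoff matrix L of any weighted digraph is semisimple: its algebraic multiplicity equals its geometric multiplicity, i.e., ind L ≤ 1 (rank L² = rank L). -/

import Mathlib

open Finset

/-- Kirchhoff (Laplacian) matrix of the weighted digraph whose arc `(j, i)`
has weight `a i j`. -/
noncomputable def kirchhoff {n : ℕ} (a : Matrix (Fin n) (Fin n) ℝ) : Matrix (Fin n) (Fin n) ℝ :=
  Matrix.of fun i j => if i = j then ∑ k ∈ Finset.univ.erase i, a i k else -a i j

lemma kirchhoff_mulVec {n : ℕ} (a : Matrix (Fin n) (Fin n) ℝ) (z : Fin n → ℝ) (i : Fin n) :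
    (kirchhoff a).mulVec z i = ∑ j, a i j * (z i - z j) := by
  have h1 : (kirchhoff a).mulVec z i = ∑ j, kirchhoff a i j * z j := rfl
  rw [h1, ← Finset.add_sum_erase _ _ (Finset.mem_univ i),
    ← Finset.add_sum_erase _ (fun j => a i j * (z i - z j)) (Finset.mem_univ i)]
  have h2 : ∑ j ∈ univ.erase i, kirchhoff a i j * z j = ∑ j ∈ univ.erase i, -a i j * z j := by
    refine Finset.sum_congr rfl fun j hj => ?_
    have : i ≠ j := fun h => Finset.ne_of_mem_erase hj h.symm
    simp [kirchhoff, this]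
  have h3 : kirchhoff a i i = ∑ k ∈ univ.erase i, a i k := by simp [kirchhoff]
  rw [h2, h3, Finset.sum_mul, ← Finset.sum_add_distrib, sub_self, mul_zero, zero_add]
  exact Finset.sum_congr rfl fun j _ => by ring

/-- Maximum principle applied to `y - t x`. -/
lemma kirchhoff_nonneg {n : ℕ} (a : Matrix (Fin n) (Fin n) ℝ) (hnn : ∀ i j, 0 ≤ a i j)
    (x y : Fin n → ℝ) (hy : (kirchhoff a).mulVec y = x) (hx : (kirchhoff a).mulVec x = 0)
    (i : Fin n) : 0 ≤ x i := by
  by_contra! hi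
  have : Nonempty (Fin n) := ⟨i⟩
  obtain ⟨m, hm⟩ := Finite.exists_max y
  have key : ∀ t : ℝ, 0 ≤ t → y i - t * x i ≤ y m := by
    intro t ht
    obtain ⟨k, hk⟩ := Finite.exists_max (fun j => y j - t * x j)
    have hL : (kirchhoff a).mulVec (y - t • x) k = x k := by
      rw [Matrix.mulVec_sub, Matrix.mulVec_smul, hy, hx]; simp
    rw [kirchhoff_mulVec] at hL
    have hpos : 0 ≤ x k := by
      rw [← hL]
      refine Finset.sum_nonneg fun j _ => mul_nonneg (hnn k j) ?_
      have := hk j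
      simp only [Pi.sub_apply, Pi.smul_apply, smul_eq_mul]
      linarith
    have h1 := hk i
    have h2 := hm k
    have h3 := mul_nonneg ht hpos
    linarith
  have h := key ((y m - y i + 1) / (-x i)) (div_nonneg (by linarith [hm i]) (by linarith))
  have : (y m - y i + 1) / (-x i) * x i = -(y m - y i + 1) := by
    field_simp [hi.ne]
  linarith

/-- The zero eigenvalue of the Kirchhoff matrix is semisimple:
`rank L² = rank L`, i.e. `ind L ≤ 1`. -/
theorem zero_eigenvalue_semisimple {n : ℕ} (a : Matrix (Fin n) (Fin n) ℝ)
    (hnn : ∀ i j, 0 ≤ a i j) :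
    (kirchhoff a * kirchhoff a).rank = (kirchhoff a).rank := by
  have hker : LinearMap.ker (kirchhoff a * kirchhoff a).mulVecLin
      = LinearMap.ker (kirchhoff a).mulVecLin := by
    ext y
    simp only [LinearMap.mem_ker, Matrix.mulVecLin_apply, ← Matrix.mulVec_mulVec]
    constructor
    · intro h
      funext i
      have h1 := kirchhoff_nonneg a hnn _ y rfl h i
      have h2 := kirchhoff_nonneg a hnn (-((kirchhoff a).mulVec y)) (-y)
        (Matrix.mulVec_neg _ _) (by rw [Matrix.mulVec_neg, h, neg_zero]) i
      simp only [Pi.neg_apply] at h2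
      simp only [Pi.zero_apply]
      linarith
    · intro h
      rw [h, Matrix.mulVec_zero]
  have e1 := LinearMap.finrank_range_add_finrank_ker (kirchhoff a * kirchhoff a).mulVecLin
  have e2 := LinearMap.finrank_range_add_finrank_ker (kirchhoff a).mulVecLin
  rw [hker] at e1
  unfold Matrix.rank
  omega
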